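/- The Einstein tensor is the Euler–Lagrange derivative of the free spin-3 Lagrangian: for any spin-3 fields h and v on ℝⁿ (n ≥ 1) all of whose components are smooth and compactly supported, the first variation of the free action satisfies (d/dt) S₀[h + t v] |_{t=0} = ∫_{ℝⁿ} v_{μνρ}(x) G^{μνρ}[h](x) dⁿx, where indices on G are raised with η^{μν}. -/

import Mathlib

open MeasureTheory

noncomputable section

/-- Mostly-plus Minkowski metric `η_{μν} = diag(−1,+1,…,+1)` on `ℝⁿ`
(it coincides with its inverse `η^{μν}`). -/
def eta (n : ℕ) (μ ν : Fin n) : ℝ :=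
  if μ = ν then (if (μ : ℕ) = 0 then -1 else 1) else 0

/-- Partial derivative `∂_μ` of a scalar function on `ℝⁿ`. -/
def pd {n : ℕ} (μ : Fin n) (f : (Fin n → ℝ) → ℝ) : (Fin n → ℝ) → ℝ :=
  fun x => fderiv ℝ f x (Pi.single μ 1)

/-- A rank-3 covariant tensor field on `ℝⁿ` (the type of spin-3 fields). -/
abbrev Spin3 (n : ℕ) := (Fin n → ℝ) → Fin n → Fin n → Fin n → ℝ

/-- Trace `h_μ := η^{νρ} h_{μνρ}`. -/
def trH {n : ℕ} (h : Spin3 n) (x : Fin n → ℝ) (μ : Fin n) : ℝ :=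
  ∑ ν, ∑ ρ, eta n ν ρ * h x μ ν ρ

/-- Fronsdal tensor
`F_{μνρ} := □h_{μνρ} − ∂^σ(∂_μ h_{νρσ} + ∂_ν h_{ρμσ} + ∂_ρ h_{μνσ})
  + ∂_μ∂_ν h_ρ + ∂_ν∂_ρ h_μ + ∂_ρ∂_μ h_ν`. -/
def fronsdal {n : ℕ} (h : Spin3 n) (x : Fin n → ℝ) (μ ν ρ : Fin n) : ℝ :=
  (∑ σ, ∑ τ, eta n σ τ * pd σ (pd τ (fun y => h y μ ν ρ)) x)
  - (∑ σ, ∑ τ, eta n σ τ *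
      pd τ (fun y => pd μ (fun z => h z ν ρ σ) y + pd ν (fun z => h z ρ μ σ) y
        + pd ρ (fun z => h z μ ν σ) y) x)
  + pd μ (pd ν (fun z => trH h z ρ)) x
  + pd ν (pd ρ (fun z => trH h z μ)) x
  + pd ρ (pd μ (fun z => trH h z ν)) x

/-- Trace of the Fronsdal tensor, `F_ρ := η^{μν} F_{μνρ}`. -/
def trF {n : ℕ} (h : Spin3 n) (x : Fin n → ℝ) (ρ : Fin n) : ℝ :=
  ∑ μ, ∑ ν, eta n μ ν * fronsdal h x μ ν ρ

/-- Einstein tensor `G_{μνρ} := F_{μνρ} − (1/2)(η_{μν}F_ρ + η_{νρ}F_μ + η_{ρμ}F_ν)`. -/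
def einstein {n : ℕ} (h : Spin3 n) (x : Fin n → ℝ) (μ ν ρ : Fin n) : ℝ :=
  fronsdal h x μ ν ρ
    - (1/2) * (eta n μ ν * trF h x ρ + eta n ν ρ * trF h x μ + eta n ρ μ * trF h x ν)

/-- Gauge transformation `(δ_λ h)_{μνρ} := ∂_μ λ_{νρ} + ∂_ν λ_{ρμ} + ∂_ρ λ_{μν}`. -/
def gaugeTransform {n : ℕ} (lam : (Fin n → ℝ) → Fin n → Fin n → ℝ) : Spin3 n :=
  fun x μ ν ρ => pd μ (fun y => lam y ν ρ) x + pd ν (fun y => lam y ρ μ) x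
    + pd ρ (fun y => lam y μ ν) x

/-- Curvature tensor `K_{αμ|βν|γρ}`: the antisymmetrization of `∂_α∂_β∂_γ h_{μνρ}`
in each of the index pairs `(α,μ)`, `(β,ν)`, `(γ,ρ)`. -/
def curvature {n : ℕ} (h : Spin3 n) (x : Fin n → ℝ) (α μ β ν γ ρ : Fin n) : ℝ :=
  pd α (pd β (pd γ (fun y => h y μ ν ρ))) x
  - pd μ (pd β (pd γ (fun y => h y α ν ρ))) x
  - pd α (pd ν (pd γ (fun y => h y μ β ρ))) x
  - pd α (pd β (pd ρ (fun y => h y μ ν γ))) x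
  + pd μ (pd ν (pd γ (fun y => h y α β ρ))) x
  + pd μ (pd β (pd ρ (fun y => h y α ν γ))) x
  + pd α (pd ν (pd ρ (fun y => h y μ β γ))) x
  - pd μ (pd ν (pd ρ (fun y => h y α β γ))) x

/-- The free Fronsdal Lagrangian density for a single spin-3 field (all
contractions performed with the Minkowski metric `η`). -/
def lag {n : ℕ} (h : Spin3 n) (x : Fin n → ℝ) : ℝ :=
  -(1/2) * (∑ σ, ∑ τ, ∑ μ, ∑ μ', ∑ ν, ∑ ν', ∑ ρ, ∑ ρ',
      eta n σ τ * eta n μ μ' * eta n ν ν' * eta n ρ ρ' *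
        pd σ (fun y => h y μ ν ρ) x * pd τ (fun y => h y μ' ν' ρ') x)
  + (3/2) * (∑ μ, ∑ μ', ∑ ν, ∑ ν', ∑ ρ, ∑ ρ', ∑ σ, ∑ σ',
      eta n μ μ' * eta n ν ν' * eta n ρ ρ' * eta n σ σ' *
        pd μ' (fun y => h y μ ρ σ) x * pd ν (fun y => h y ν' ρ' σ') x)
  + (3/2) * (∑ μ, ∑ μ', ∑ ν, ∑ ν',
      eta n μ μ' * eta n ν ν' * pd μ (fun y => trH h y ν) x * pd μ' (fun y => trH h y ν') x)
  + (3/4) * (∑ μ, ∑ μ', ∑ ν, ∑ ν',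
      eta n μ μ' * eta n ν ν' * pd μ (fun y => trH h y μ') x * pd ν (fun y => trH h y ν') x)
  - 3 * (∑ μ, ∑ μ', ∑ ν, ∑ ν', ∑ ρ, ∑ ρ',
      eta n μ μ' * eta n ν ν' * eta n ρ ρ' *
        pd μ (fun y => trH h y ν) x * pd ρ (fun y => h y ρ' μ' ν') x)

/-- The free spin-3 (Fronsdal) action for a single field. -/
def action {n : ℕ} (h : Spin3 n) : ℝ := ∫ x : Fin n → ℝ, lag h x

/-- The diagonal entries of the Minkowski metric. -/
def etaDiag (n : ℕ) (μ : Fin n) : ℝ := eta n μ μ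

lemma eta_eq_ite {n : ℕ} (μ ν : Fin n) : eta n μ ν = if μ = ν then etaDiag n μ else 0 := by
  unfold etaDiag eta
  split_ifs <;> simp_all

lemma etaDiag_mul_self {n : ℕ} (μ : Fin n) : etaDiag n μ * etaDiag n μ = 1 := by
  unfold etaDiag eta
  split_ifs <;> simp_all

lemma sum_eta_mul {n : ℕ} (μ : Fin n) (f : Fin n → ℝ) :
    ∑ ν, eta n μ ν * f ν = etaDiag n μ * f μ := by
  simp [eta_eq_ite]

/-- Smooth, compactly supported scalar functions on `ℝⁿ`. -/
def IsTest {n : ℕ} (f : (Fin n → ℝ) → ℝ) : Prop :=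
  ContDiff ℝ (⊤ : ℕ∞) f ∧ HasCompactSupport f

namespace IsTest

variable {n : ℕ} {f g : (Fin n → ℝ) → ℝ}

lemma differentiable (hf : IsTest f) : Differentiable ℝ f :=
  hf.1.differentiable (by simp)

lemma integrable (hf : IsTest f) : Integrable f :=
  hf.1.continuous.integrable_of_hasCompactSupport hf.2

lemma partial_deriv (hf : IsTest f) (μ : Fin n) : IsTest (pd μ f) := by
  refine ⟨(hf.1.fderiv_right (m := (⊤ : ℕ∞)) (by simp)).clm_apply contDiff_const, ?_⟩
  exact hf.2.fderiv_apply ℝ _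

lemma add (hf : IsTest f) (hg : IsTest g) : IsTest fun x => f x + g x :=
  ⟨hf.1.add hg.1, hf.2.add hg.2⟩

lemma mul (hf : IsTest f) (hg : IsTest g) : IsTest fun x => f x * g x :=
  ⟨hf.1.mul hg.1, hf.2.mul_right⟩

lemma const_mul (c : ℝ) (hf : IsTest f) : IsTest fun x => c * f x :=
  ⟨contDiff_const.mul hf.1, hf.2.mul_left⟩

lemma sub (hf : IsTest f) (hg : IsTest g) : IsTest fun x => f x - g x := by
  simpa only [sub_eq_add_neg, neg_one_mul] using hf.add (hg.const_mul (-1))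

lemma sum {ι : Type*} (s : Finset ι) {F : ι → (Fin n → ℝ) → ℝ} (hF : ∀ i, IsTest (F i)) :
    IsTest fun x => ∑ i ∈ s, F i x := by
  classical
  induction s using Finset.induction_on with
  | empty => exact ⟨by simpa using contDiff_const, HasCompactSupport.zero⟩
  | insert a s ha ih => simpa [Finset.sum_insert ha] using (hF a).add ih

end IsTest

section PartialDerivatives

variable {n : ℕ} {f g : (Fin n → ℝ) → ℝ}

lemma pd_add (hf : IsTest f) (hg : IsTest g) (μ : Fin n) (x : Fin n → ℝ) :
    pd μ (fun y => f y + g y) x = pd μ f x + pd μ g x := by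
  simp [pd, fderiv_fun_add (hf.differentiable x) (hg.differentiable x)]

lemma pd_const_mul (c : ℝ) (hf : IsTest f) (μ : Fin n) (x : Fin n → ℝ) :
    pd μ (fun y => c * f y) x = c * pd μ f x := by
  simp [pd, fderiv_const_mul (hf.differentiable x)]

lemma pd_mul (hf : IsTest f) (hg : IsTest g) (μ : Fin n) (x : Fin n → ℝ) :
    pd μ (fun y => f y * g y) x = pd μ f x * g x + f x * pd μ g x := by
  simp [pd, fderiv_fun_mul (hf.differentiable x) (hg.differentiable x)]
  ring

lemma pd_sum {ι : Type*} (s : Finset ι) {F : ι → (Fin n → ℝ) → ℝ} (hF : ∀ i, IsTest (F i))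
    (μ : Fin n) (x : Fin n → ℝ) :
    pd μ (fun y => ∑ i ∈ s, F i y) x = ∑ i ∈ s, pd μ (F i) x := by
  simp [pd, fderiv_fun_sum fun i _ => (hF i).differentiable x]

lemma pd_comm (hf : IsTest f) (μ ν : Fin n) (x : Fin n → ℝ) :
    pd μ (pd ν f) x = pd ν (pd μ f) x := by
  have hd : DifferentiableAt ℝ (fderiv ℝ f) x :=
    ((hf.1.fderiv_right (m := (⊤ : ℕ∞)) (by simp)).differentiable (by simp)) x
  have key (a b : Fin n) : pd a (pd b f) x
      = fderiv ℝ (fderiv ℝ f) x (Pi.single a 1) (Pi.single b 1) := by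
    unfold pd
    rw [fderiv_clm_apply hd (differentiableAt_const _)]
    simp
  rw [key, key]
  have two_le : minSmoothness ℝ 2 ≤ ((⊤ : ℕ∞) : WithTop ℕ∞) := by
    simpa using WithTop.coe_le_coe.2 (le_top : (2 : ℕ∞) ≤ ⊤)
  exact hf.1.contDiffAt.isSymmSndFDerivAt two_le _ _

lemma integral_pd_eq_zero (hf : IsTest f) (μ : Fin n) : ∫ x, pd μ f x = 0 := by
  have hi : Integrable fun x => fderiv ℝ f x (Pi.single μ 1) := (hf.partial_deriv μ).integrable
  have := integral_mul_fderiv_eq_neg_fderiv_mul_of_integrable (𝕜 := ℝ) (μ := volume)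
    (f := fun _ : Fin n → ℝ => (1 : ℝ)) (g := f) (v := Pi.single μ 1)
    (by simp) (by simpa using hi) (by simpa using hf.integrable)
    (fun _ _ => differentiableAt_const _) (fun x _ => hf.differentiable x)
  simpa [pd] using this

end PartialDerivatives

/-- Integrable functions with vanishing integral. -/
def IsNull {n : ℕ} (f : (Fin n → ℝ) → ℝ) : Prop := Integrable f ∧ ∫ x, f x = 0

namespace IsNull

variable {n : ℕ} {f g : (Fin n → ℝ) → ℝ}

lemma partial_deriv (hf : IsTest f) (μ : Fin n) : IsNull (pd μ f) :=
  ⟨(hf.partial_deriv μ).integrable, integral_pd_eq_zero hf μ⟩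

lemma const_mul (c : ℝ) (hf : IsNull f) : IsNull fun x => c * f x :=
  ⟨hf.1.const_mul c, by rw [integral_const_mul, hf.2, mul_zero]⟩

lemma add (hf : IsNull f) (hg : IsNull g) : IsNull fun x => f x + g x :=
  ⟨hf.1.add hg.1, by rw [integral_add hf.1 hg.1, hf.2, hg.2, add_zero]⟩

lemma sum {ι : Type*} (s : Finset ι) {F : ι → (Fin n → ℝ) → ℝ} (hF : ∀ i, IsNull (F i)) :
    IsNull fun x => ∑ i ∈ s, F i x :=
  ⟨integrable_finsetSum s fun i _ => (hF i).1, by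
    rw [integral_finsetSum s fun i _ => (hF i).1]
    exact Finset.sum_eq_zero fun i _ => (hF i).2⟩

end IsNull

section Contractions

variable {n : ℕ}

/-- Divergence `∂^σ h_{σμν}`. -/
def divH (h : Spin3 n) (x : Fin n → ℝ) (μ ν : Fin n) : ℝ :=
  ∑ σ, etaDiag n σ * pd σ (fun y => h y σ μ ν) x

/-- Divergence of the trace `∂^σ h_σ`. -/
def divTr (h : Spin3 n) (x : Fin n → ℝ) : ℝ :=
  ∑ σ, etaDiag n σ * pd σ (fun y => trH h y σ) x

/-- The symmetric bilinear form polarizing the free Lagrangian density. -/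
def lagBilin (h v : Spin3 n) (x : Fin n → ℝ) : ℝ :=
  -(1/2) * (∑ σ, ∑ μ, ∑ ν, ∑ ρ, etaDiag n σ * etaDiag n μ * etaDiag n ν * etaDiag n ρ *
      (pd σ (fun y => h y μ ν ρ) x * pd σ (fun y => v y μ ν ρ) x))
  + (3/2) * (∑ μ, ∑ ν, etaDiag n μ * etaDiag n ν * (divH h x μ ν * divH v x μ ν))
  + (3/2) * (∑ μ, ∑ ν, etaDiag n μ * etaDiag n ν *
      (pd μ (fun y => trH h y ν) x * pd μ (fun y => trH v y ν) x))
  + (3/4) * (divTr h x * divTr v x)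
  - (3/2) * (∑ μ, ∑ ν, etaDiag n μ * etaDiag n ν *
      (pd μ (fun y => trH h y ν) x * divH v x μ ν + pd μ (fun y => trH v y ν) x * divH h x μ ν))

lemma sum_rotate (f : Fin n → Fin n → Fin n → ℝ) :
    ∑ a, ∑ b, ∑ c, f a b c = ∑ a, ∑ b, ∑ c, f b c a :=
  calc _ = ∑ a, ∑ c, ∑ b, f a b c := Finset.sum_congr rfl fun _ _ => Finset.sum_comm
    _ = _ := Finset.sum_comm

lemma sum_comm_first (f : Fin n → Fin n → Fin n → Fin n → ℝ) :
    ∑ a, ∑ b, ∑ c, ∑ d, f a b c d = ∑ b, ∑ c, ∑ d, ∑ a, f a b c d :=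
  Finset.sum_comm.trans <| Finset.sum_congr rfl fun _ _ => Finset.sum_comm.trans <|
    Finset.sum_congr rfl fun _ _ => Finset.sum_comm

lemma sum_comm_pairs (f : Fin n → Fin n → Fin n → Fin n → ℝ) :
    ∑ a, ∑ b, ∑ c, ∑ d, f a b c d = ∑ c, ∑ d, ∑ a, ∑ b, f a b c d :=
  (sum_comm_first f).trans (sum_comm_first fun b c d a => f a b c d)

lemma trH_eq (h : Spin3 n) (x : Fin n → ℝ) (μ : Fin n) :
    trH h x μ = ∑ ν, etaDiag n ν * h x μ ν ν := by
  simp only [trH, sum_eta_mul]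

lemma lag_eq_lagBilin (h : Spin3 n) (x : Fin n → ℝ) : lag h x = lagBilin h h x := by
  unfold lag lagBilin
  congr 1
  · congr 1
    · congr 1
      · congr 1
        · congr 1
          simp only [eta_eq_ite, ite_mul, mul_ite, zero_mul, mul_zero, Finset.sum_ite_irrel,
            Finset.sum_const_zero, Finset.sum_ite_eq, Finset.mem_univ, if_true, mul_assoc]
        · congr 1
          simp only [eta_eq_ite, ite_mul, mul_ite, zero_mul, mul_zero, Finset.sum_ite_irrel,
            Finset.sum_const_zero, Finset.sum_ite_eq, Finset.mem_univ, if_true]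
          rw [sum_comm_pairs]
          simp only [divH, Finset.sum_mul_sum]
          simp only [Finset.mul_sum]
          refine Finset.sum_congr rfl fun μ _ => Finset.sum_congr rfl fun ν _ =>
            Finset.sum_congr rfl fun ρ _ => Finset.sum_congr rfl fun σ _ => ?_
          ring
      · congr 1
        simp only [eta_eq_ite, ite_mul, mul_ite, zero_mul, mul_zero, Finset.sum_ite_irrel,
          Finset.sum_const_zero, Finset.sum_ite_eq, Finset.mem_univ, if_true, mul_assoc]
    · congr 1
      simp only [eta_eq_ite, ite_mul, mul_ite, zero_mul, mul_zero, Finset.sum_ite_irrel,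
        Finset.sum_const_zero, Finset.sum_ite_eq, Finset.mem_univ, if_true]
      simp only [divTr, Finset.sum_mul_sum]
      refine Finset.sum_congr rfl fun μ _ => Finset.sum_congr rfl fun ν _ => ?_
      ring
  · simp only [eta_eq_ite, ite_mul, mul_ite, zero_mul, mul_zero, Finset.sum_ite_irrel,
      Finset.sum_const_zero, Finset.sum_ite_eq, Finset.mem_univ, if_true]
    simp only [divH, Finset.mul_sum, ← Finset.sum_add_distrib]
    refine Finset.sum_congr rfl fun μ _ => Finset.sum_congr rfl fun ν _ =>
      Finset.sum_congr rfl fun ρ _ => ?_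
    ring

variable {h v : Spin3 n}

lemma isTest_trH (hh : ∀ μ ν ρ, IsTest fun x => h x μ ν ρ) (μ : Fin n) :
    IsTest fun x => trH h x μ := by
  simp only [trH_eq]
  exact IsTest.sum _ fun ν => (hh μ ν ν).const_mul _

lemma isTest_divH (hh : ∀ μ ν ρ, IsTest fun x => h x μ ν ρ) (μ ν : Fin n) :
    IsTest fun x => divH h x μ ν :=
  IsTest.sum _ fun σ => ((hh σ μ ν).partial_deriv σ).const_mul _

lemma isTest_divTr (hh : ∀ μ ν ρ, IsTest fun x => h x μ ν ρ) : IsTest fun x => divTr h x :=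
  IsTest.sum _ fun σ => ((isTest_trH hh σ).partial_deriv σ).const_mul _

lemma pd_sum_const_mul {c : Fin n → ℝ} {F : Fin n → (Fin n → ℝ) → ℝ} (hF : ∀ i, IsTest (F i))
    (μ : Fin n) (x : Fin n → ℝ) :
    pd μ (fun y => ∑ i, c i * F i y) x = ∑ i, c i * pd μ (F i) x := by
  rw [pd_sum _ (fun i => (hF i).const_mul (c i))]
  exact Finset.sum_congr rfl fun i _ => pd_const_mul _ (hF i) _ _

lemma pd_trH (hh : ∀ μ ν ρ, IsTest fun x => h x μ ν ρ) (σ μ : Fin n) :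
    pd σ (fun y => trH h y μ) = fun x => ∑ ν, etaDiag n ν * pd σ (fun y => h y μ ν ν) x := by
  funext x
  simp only [trH_eq]
  exact pd_sum_const_mul (fun ν => hh μ ν ν) σ x

lemma pd_divH (hh : ∀ μ ν ρ, IsTest fun x => h x μ ν ρ) (μ ν ρ : Fin n) (x : Fin n → ℝ) :
    pd μ (fun y => divH h y ν ρ) x
      = ∑ σ, etaDiag n σ * pd σ (pd μ fun y => h y σ ν ρ) x := by
  unfold divH
  rw [pd_sum_const_mul fun σ => (hh σ ν ρ).partial_deriv σ]
  exact Finset.sum_congr rfl fun σ _ => by rw [pd_comm (hh σ ν ρ)]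

lemma pd_divTr (hh : ∀ μ ν ρ, IsTest fun x => h x μ ν ρ) (μ : Fin n) (x : Fin n → ℝ) :
    pd μ (fun y => divTr h y) x
      = ∑ σ, etaDiag n σ * pd μ (pd σ fun y => trH h y σ) x :=
  pd_sum_const_mul (fun σ => (isTest_trH hh σ).partial_deriv σ) μ x

lemma divH_symm (h₂ : ∀ x μ ν ρ, h x μ ν ρ = h x μ ρ ν) (x : Fin n → ℝ) (μ ν : Fin n) :
    divH h x μ ν = divH h x ν μ := by
  simp only [divH, h₂ _ _ μ ν]

lemma sum_mul_divH (v : Spin3 n) (x : Fin n → ℝ) (X : Fin n → Fin n → ℝ) :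
    ∑ μ, ∑ ν, etaDiag n μ * etaDiag n ν * (X μ ν * divH v x μ ν)
      = ∑ σ, ∑ μ, ∑ ν, etaDiag n σ * etaDiag n μ * etaDiag n ν *
        (pd σ (fun y => v y σ μ ν) x * X μ ν) := by
  refine Eq.trans ?_ (sum_rotate fun μ ν σ => etaDiag n σ * etaDiag n μ * etaDiag n ν *
    (pd σ (fun y => v y σ μ ν) x * X μ ν))
  simp only [divH, Finset.mul_sum]
  refine Finset.sum_congr rfl fun μ _ => Finset.sum_congr rfl fun ν _ =>
    Finset.sum_congr rfl fun σ _ => ?_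
  ring

lemma divTr_eq_sum_divH (hh : ∀ μ ν ρ, IsTest fun x => h x μ ν ρ) (x : Fin n → ℝ) :
    divTr h x = ∑ μ, etaDiag n μ * divH h x μ μ := by
  simp only [divTr, pd_trH hh, divH, Finset.mul_sum]
  rw [Finset.sum_comm]
  exact Finset.sum_congr rfl fun μ _ => Finset.sum_congr rfl fun ν _ => by ring

lemma fronsdal_eq (hh : ∀ μ ν ρ, IsTest fun x => h x μ ν ρ)
    (h₁ : ∀ x μ ν ρ, h x μ ν ρ = h x ν μ ρ) (h₂ : ∀ x μ ν ρ, h x μ ν ρ = h x μ ρ ν)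
    (x : Fin n → ℝ) (μ ν ρ : Fin n) :
    fronsdal h x μ ν ρ
      = ∑ σ, etaDiag n σ * pd σ (pd σ fun y => h y μ ν ρ) x
        - (pd μ (fun y => divH h y ν ρ) x + pd ν (fun y => divH h y ρ μ) x
          + pd ρ (fun y => divH h y μ ν) x)
        + pd μ (pd ν fun y => trH h y ρ) x + pd ν (pd ρ fun y => trH h y μ) x
        + pd ρ (pd μ fun y => trH h y ν) x := by
  have cyc : ∀ x a b σ, h x a b σ = h x σ a b := fun x a b σ => by rw [h₂, h₁]
  have hp : ∀ a b c d, IsTest (pd a fun y => h y b c d) := fun a b c d =>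
    (hh b c d).partial_deriv a
  unfold fronsdal
  simp only [sum_eta_mul, pd_divH hh]
  congr 4
  simp only [← Finset.sum_add_distrib]
  refine Finset.sum_congr rfl fun σ _ => ?_
  rw [pd_add ((hp _ _ _ _).add (hp _ _ _ _)) (hp _ _ _ _), pd_add (hp _ _ _ _) (hp _ _ _ _)]
  simp only [cyc _ _ _ σ]
  ring

lemma trF_eq (hh : ∀ μ ν ρ, IsTest fun x => h x μ ν ρ)
    (h₁ : ∀ x μ ν ρ, h x μ ν ρ = h x ν μ ρ) (h₂ : ∀ x μ ν ρ, h x μ ν ρ = h x μ ρ ν)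
    (x : Fin n → ℝ) (ρ : Fin n) :
    trF h x ρ
      = 2 * ∑ σ, etaDiag n σ * pd σ (pd σ fun y => trH h y ρ) x
        - 2 * ∑ σ, etaDiag n σ * pd σ (fun y => divH h y σ ρ) x
        + pd ρ (fun y => divTr h y) x := by
  have box : ∑ μ, etaDiag n μ * ∑ σ, etaDiag n σ * pd σ (pd σ fun y => h y μ μ ρ) x
      = ∑ σ, etaDiag n σ * pd σ (pd σ fun y => trH h y ρ) x := by
    have (σ : Fin n) : pd σ (pd σ fun y => trH h y ρ) x
        = ∑ μ, etaDiag n μ * pd σ (pd σ fun y => h y ρ μ μ) x := by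
      rw [pd_trH hh, pd_sum_const_mul fun μ => (hh ρ μ μ).partial_deriv σ]
    simp only [this, Finset.mul_sum]
    rw [Finset.sum_comm]
    refine Finset.sum_congr rfl fun σ _ => Finset.sum_congr rfl fun μ _ => ?_
    simp only [fun y => (h₂ y μ μ ρ).trans (h₁ y μ ρ μ)]
    ring
  have tr : ∑ μ, etaDiag n μ * pd ρ (fun y => divH h y μ μ) x = pd ρ (fun y => divTr h y) x := by
    simp only [divTr_eq_sum_divH hh]
    rw [pd_sum_const_mul fun μ => isTest_divH hh μ μ]
  have tr' : ∑ μ, etaDiag n μ * pd ρ (pd μ fun y => trH h y μ) x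
      = pd ρ (fun y => divTr h y) x := (pd_divTr hh ρ x).symm
  unfold trF
  simp only [sum_eta_mul, fronsdal_eq hh h₁ h₂]
  simp only [pd_comm (isTest_trH hh _) _ ρ, divH_symm h₂ _ ρ]
  have split (μ : Fin n) (a b c d e : ℝ) : etaDiag n μ * (a - (b + b + c) + d + e + e)
      = etaDiag n μ * a - 2 * (etaDiag n μ * b) - etaDiag n μ * c + etaDiag n μ * d
        + 2 * (etaDiag n μ * e) := by ring
  simp only [split, Finset.sum_add_distrib, Finset.sum_sub_distrib, ← Finset.mul_sum, box, tr, tr']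
  ring

lemma sum_eta_diag_eq_trH (v₁ : ∀ x μ ν ρ, v x μ ν ρ = v x ν μ ρ) (v₂ : ∀ x μ ν ρ, v x μ ν ρ = v x μ ρ ν)
    (x : Fin n → ℝ) (ρ : Fin n) : ∑ μ, etaDiag n μ * v x μ μ ρ = trH v x ρ := by
  rw [trH_eq]
  exact Finset.sum_congr rfl fun μ _ => by rw [v₂ x μ μ ρ, v₁ x μ ρ μ]

/-- Full contraction of `v` with a rank-3 tensor. -/
def contr (v : Spin3 n) (x : Fin n → ℝ) (X : Fin n → Fin n → Fin n → ℝ) : ℝ :=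
  ∑ μ, ∑ ν, ∑ ρ, etaDiag n μ * etaDiag n ν * etaDiag n ρ * (v x μ ν ρ * X μ ν ρ)

lemma contr_add (x : Fin n → ℝ) (X Y : Fin n → Fin n → Fin n → ℝ) :
    contr v x (fun μ ν ρ => X μ ν ρ + Y μ ν ρ) = contr v x X + contr v x Y := by
  simp only [contr, mul_add, Finset.sum_add_distrib]

lemma contr_sub (x : Fin n → ℝ) (X Y : Fin n → Fin n → Fin n → ℝ) :
    contr v x (fun μ ν ρ => X μ ν ρ - Y μ ν ρ) = contr v x X - contr v x Y := by
  simp only [contr, mul_sub, Finset.sum_sub_distrib]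

lemma contr_const_mul (x : Fin n → ℝ) (c : ℝ) (X : Fin n → Fin n → Fin n → ℝ) :
    contr v x (fun μ ν ρ => c * X μ ν ρ) = c * contr v x X := by
  simp only [contr, Finset.mul_sum]
  refine Finset.sum_congr rfl fun μ _ => Finset.sum_congr rfl fun ν _ =>
    Finset.sum_congr rfl fun ρ _ => ?_
  ring

lemma contr_rotate (v₁ : ∀ x μ ν ρ, v x μ ν ρ = v x ν μ ρ)
    (v₂ : ∀ x μ ν ρ, v x μ ν ρ = v x μ ρ ν) (x : Fin n → ℝ) (X : Fin n → Fin n → Fin n → ℝ) :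
    contr v x (fun μ ν ρ => X ν ρ μ) = contr v x X := by
  unfold contr
  rw [sum_rotate fun μ ν ρ => etaDiag n μ * etaDiag n ν * etaDiag n ρ * (v x μ ν ρ * X μ ν ρ)]
  refine Finset.sum_congr rfl fun μ _ => Finset.sum_congr rfl fun ν _ =>
    Finset.sum_congr rfl fun ρ _ => ?_
  rw [v₁ x μ ν ρ, v₂ x ν μ ρ]
  ring

lemma contr_eta_mul (v₁ : ∀ x μ ν ρ, v x μ ν ρ = v x ν μ ρ)
    (v₂ : ∀ x μ ν ρ, v x μ ν ρ = v x μ ρ ν) (x : Fin n → ℝ) (w : Fin n → ℝ) :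
    contr v x (fun μ ν ρ => eta n μ ν * w ρ) = ∑ ρ, etaDiag n ρ * (trH v x ρ * w ρ) := by
  simp only [← sum_eta_diag_eq_trH v₁ v₂, contr, eta_eq_ite, ite_mul, mul_ite, zero_mul, mul_zero,
    Finset.sum_ite_irrel, Finset.sum_const_zero, Finset.sum_ite_eq, Finset.mem_univ, if_true]
  rw [Finset.sum_comm]
  simp only [Finset.sum_mul, Finset.mul_sum]
  refine Finset.sum_congr rfl fun ρ _ => Finset.sum_congr rfl fun μ _ => ?_
  linear_combination (etaDiag n μ * etaDiag n ρ * v x μ μ ρ * w ρ) * etaDiag_mul_self μ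

lemma contr_einstein (v₁ : ∀ x μ ν ρ, v x μ ν ρ = v x ν μ ρ)
    (v₂ : ∀ x μ ν ρ, v x μ ν ρ = v x μ ρ ν) (x : Fin n → ℝ) :
    contr v x (einstein h x)
      = contr v x (fronsdal h x) - (3/2) * ∑ ρ, etaDiag n ρ * (trH v x ρ * trF h x ρ) := by
  have e₁ := contr_eta_mul v₁ v₂ x (trF h x)
  have e₂ := contr_rotate v₁ v₂ x fun μ ν ρ => eta n μ ν * trF h x ρ
  have e₃ := contr_rotate v₁ v₂ x fun μ ν ρ => eta n ν ρ * trF h x μ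
  have : einstein h x = fun μ ν ρ => fronsdal h x μ ν ρ - (1/2) *
    (eta n μ ν * trF h x ρ + eta n ν ρ * trF h x μ + eta n ρ μ * trF h x ν) := rfl
  rw [this, contr_sub, contr_const_mul, contr_add, contr_add, e₃, e₂, e₁]
  ring

lemma contr_fronsdal (hh : ∀ μ ν ρ, IsTest fun x => h x μ ν ρ)
    (h₁ : ∀ x μ ν ρ, h x μ ν ρ = h x ν μ ρ) (h₂ : ∀ x μ ν ρ, h x μ ν ρ = h x μ ρ ν)
    (v₁ : ∀ x μ ν ρ, v x μ ν ρ = v x ν μ ρ) (v₂ : ∀ x μ ν ρ, v x μ ν ρ = v x μ ρ ν)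
    (x : Fin n → ℝ) :
    contr v x (fronsdal h x)
      = contr v x (fun μ ν ρ => ∑ σ, etaDiag n σ * pd σ (pd σ fun y => h y μ ν ρ) x)
        - 3 * contr v x (fun μ ν ρ => pd μ (fun y => divH h y ν ρ) x)
        + 3 * contr v x (fun μ ν ρ => pd μ (pd ν fun y => trH h y ρ) x) := by
  have d₁ := contr_rotate v₁ v₂ x fun μ ν ρ => pd μ (fun y => divH h y ν ρ) x
  have d₂ := contr_rotate v₁ v₂ x fun μ ν ρ => pd ν (fun y => divH h y ρ μ) x
  have t₁ := contr_rotate v₁ v₂ x fun μ ν ρ => pd μ (pd ν fun y => trH h y ρ) x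
  have t₂ := contr_rotate v₁ v₂ x fun μ ν ρ => pd ν (pd ρ fun y => trH h y μ) x
  change contr v x (fun μ ν ρ => fronsdal h x μ ν ρ) = _
  simp only [fronsdal_eq hh h₁ h₂]
  rw [contr_add, contr_add, contr_add, contr_sub, contr_add, contr_add, d₂, d₁, t₂, t₁]
  ring

/-- The divergence relating twice the polarized Lagrangian to the Einstein tensor, as a sum of
partial derivatives. -/
def boundaryTerm (h v : Spin3 n) (x : Fin n → ℝ) : ℝ :=
  (-1) * (∑ σ, ∑ μ, ∑ ν, ∑ ρ, (etaDiag n σ * etaDiag n μ * etaDiag n ν * etaDiag n ρ) *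
      pd σ (fun y => v y μ ν ρ * pd σ (fun z => h z μ ν ρ) y) x)
  + 3 * (∑ μ, ∑ ν, ∑ ρ, (etaDiag n μ * etaDiag n ν * etaDiag n ρ) *
      pd μ (fun y => v y μ ν ρ * divH h y ν ρ) x)
  + 3 * (∑ μ, ∑ ν, (etaDiag n μ * etaDiag n ν) *
      pd μ (fun y => trH v y ν * pd μ (fun z => trH h z ν) y) x)
  + (3/2) * (∑ μ, etaDiag n μ * pd μ (fun y => trH v y μ * divTr h y) x)
  + (-3) * (∑ μ, ∑ ν, (etaDiag n μ * etaDiag n ν) *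
      pd μ (fun y => trH v y ν * divH h y μ ν) x)
  + (-3) * (∑ μ, ∑ ν, ∑ ρ, (etaDiag n μ * etaDiag n ν * etaDiag n ρ) *
      pd μ (fun y => v y μ ν ρ * pd ν (fun z => trH h z ρ) y) x)

lemma isNull_boundaryTerm (hh : ∀ μ ν ρ, IsTest fun x => h x μ ν ρ)
    (hv : ∀ μ ν ρ, IsTest fun x => v x μ ν ρ) : IsNull (boundaryTerm h v) := by
  have hT := isTest_trH hh
  have vT := isTest_trH hv
  have hD := isTest_divH hh
  refine ((((IsNull.add (.const_mul _ ?_) (.const_mul _ ?_)).add (.const_mul _ ?_)).add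
    (.const_mul _ ?_)).add (.const_mul _ ?_)).add (.const_mul _ ?_)
  · exact .sum _ fun σ => .sum _ fun μ => .sum _ fun ν => .sum _ fun ρ => .const_mul _ <|
      .partial_deriv ((hv μ ν ρ).mul ((hh μ ν ρ).partial_deriv σ)) σ
  · exact .sum _ fun μ => .sum _ fun ν => .sum _ fun ρ => .const_mul _ <|
      .partial_deriv ((hv μ ν ρ).mul (hD ν ρ)) μ
  · exact .sum _ fun μ => .sum _ fun ν => .const_mul _ <|
      .partial_deriv ((vT ν).mul ((hT ν).partial_deriv μ)) μ
  · exact .sum _ fun μ => .const_mul _ <| .partial_deriv ((vT μ).mul (isTest_divTr hh)) μ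
  · exact .sum _ fun μ => .sum _ fun ν => .const_mul _ <|
      .partial_deriv ((vT ν).mul (hD μ ν)) μ
  · exact .sum _ fun μ => .sum _ fun ν => .sum _ fun ρ => .const_mul _ <|
      .partial_deriv ((hv μ ν ρ).mul ((hT ρ).partial_deriv ν)) μ

lemma two_mul_lagBilin_eq (hh : ∀ μ ν ρ, IsTest fun x => h x μ ν ρ)
    (hv : ∀ μ ν ρ, IsTest fun x => v x μ ν ρ)
    (h₁ : ∀ x μ ν ρ, h x μ ν ρ = h x ν μ ρ) (h₂ : ∀ x μ ν ρ, h x μ ν ρ = h x μ ρ ν)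
    (v₁ : ∀ x μ ν ρ, v x μ ν ρ = v x ν μ ρ) (v₂ : ∀ x μ ν ρ, v x μ ν ρ = v x μ ρ ν)
    (x : Fin n → ℝ) :
    2 * lagBilin h v x = contr v x (einstein h x) + boundaryTerm h v x := by
  have hT := isTest_trH hh
  have vT := isTest_trH hv
  have hD := isTest_divH hh
  have n₁ : ∑ σ, ∑ μ, ∑ ν, ∑ ρ, (etaDiag n σ * etaDiag n μ * etaDiag n ν * etaDiag n ρ) *
      pd σ (fun y => v y μ ν ρ * pd σ (fun z => h z μ ν ρ) y) x
      = ∑ σ, ∑ μ, ∑ ν, ∑ ρ, etaDiag n σ * etaDiag n μ * etaDiag n ν * etaDiag n ρ *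
        (pd σ (fun y => h y μ ν ρ) x * pd σ (fun y => v y μ ν ρ) x)
      + contr v x (fun μ ν ρ => ∑ σ, etaDiag n σ * pd σ (pd σ fun y => h y μ ν ρ) x) := by
    have : contr v x (fun μ ν ρ => ∑ σ, etaDiag n σ * pd σ (pd σ fun y => h y μ ν ρ) x)
        = ∑ σ, ∑ μ, ∑ ν, ∑ ρ, etaDiag n σ * etaDiag n μ * etaDiag n ν * etaDiag n ρ *
        (v x μ ν ρ * pd σ (pd σ fun y => h y μ ν ρ) x) := by
      rw [sum_comm_first]
      refine Finset.sum_congr rfl fun μ _ => Finset.sum_congr rfl fun ν _ =>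
        Finset.sum_congr rfl fun ρ _ => ?_
      simp only [Finset.mul_sum]
      exact Finset.sum_congr rfl fun σ _ => by ring
    rw [this]
    simp only [← Finset.sum_add_distrib]
    refine Finset.sum_congr rfl fun σ _ => Finset.sum_congr rfl fun μ _ =>
      Finset.sum_congr rfl fun ν _ => Finset.sum_congr rfl fun ρ _ => ?_
    rw [pd_mul (hv μ ν ρ) ((hh μ ν ρ).partial_deriv σ)]
    ring
  have n₂ : ∑ μ, ∑ ν, ∑ ρ, (etaDiag n μ * etaDiag n ν * etaDiag n ρ) *
      pd μ (fun y => v y μ ν ρ * divH h y ν ρ) x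
      = ∑ μ, ∑ ν, etaDiag n μ * etaDiag n ν * (divH h x μ ν * divH v x μ ν)
      + contr v x (fun μ ν ρ => pd μ (fun y => divH h y ν ρ) x) := by
    rw [sum_mul_divH v x (divH h x)]
    simp only [contr, ← Finset.sum_add_distrib]
    refine Finset.sum_congr rfl fun μ _ => Finset.sum_congr rfl fun ν _ =>
      Finset.sum_congr rfl fun ρ _ => ?_
    rw [pd_mul (hv μ ν ρ) (hD ν ρ)]
    ring
  have n₃ : ∑ μ, ∑ ν, (etaDiag n μ * etaDiag n ν) *
      pd μ (fun y => trH v y ν * pd μ (fun z => trH h z ν) y) x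
      = ∑ μ, ∑ ν, etaDiag n μ * etaDiag n ν *
        (pd μ (fun y => trH h y ν) x * pd μ (fun y => trH v y ν) x)
      + ∑ ν, etaDiag n ν * (trH v x ν *
        ∑ μ, etaDiag n μ * pd μ (pd μ fun y => trH h y ν) x) := by
    rw [Finset.sum_comm, Finset.sum_comm (f := fun μ ν => etaDiag n μ * etaDiag n ν *
        (pd μ (fun y => trH h y ν) x * pd μ (fun y => trH v y ν) x))]
    simp only [Finset.mul_sum, ← Finset.sum_add_distrib]
    refine Finset.sum_congr rfl fun ν _ => Finset.sum_congr rfl fun μ _ => ?_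
    rw [pd_mul (vT ν) ((hT ν).partial_deriv μ)]
    ring
  have n₄ : ∑ μ, etaDiag n μ * pd μ (fun y => trH v y μ * divTr h y) x
      = divTr h x * divTr v x
      + ∑ μ, etaDiag n μ * (trH v x μ * pd μ (fun y => divTr h y) x) := by
    rw [divTr.eq_def v, Finset.mul_sum, ← Finset.sum_add_distrib]
    refine Finset.sum_congr rfl fun μ _ => ?_
    rw [pd_mul (vT μ) (isTest_divTr hh)]
    ring
  have n₅ : ∑ μ, ∑ ν, (etaDiag n μ * etaDiag n ν) *
      pd μ (fun y => trH v y ν * divH h y μ ν) x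
      = ∑ μ, ∑ ν, etaDiag n μ * etaDiag n ν * (pd μ (fun y => trH v y ν) x * divH h x μ ν)
      + ∑ ν, etaDiag n ν * (trH v x ν *
        ∑ μ, etaDiag n μ * pd μ (fun y => divH h y μ ν) x) := by
    rw [Finset.sum_comm, Finset.sum_comm (f := fun μ ν => etaDiag n μ * etaDiag n ν *
        (pd μ (fun y => trH v y ν) x * divH h x μ ν))]
    simp only [Finset.mul_sum, ← Finset.sum_add_distrib]
    refine Finset.sum_congr rfl fun ν _ => Finset.sum_congr rfl fun μ _ => ?_
    rw [pd_mul (vT ν) (hD μ ν)]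
    ring
  have n₆ : ∑ μ, ∑ ν, ∑ ρ, (etaDiag n μ * etaDiag n ν * etaDiag n ρ) *
      pd μ (fun y => v y μ ν ρ * pd ν (fun z => trH h z ρ) y) x
      = ∑ μ, ∑ ν, etaDiag n μ * etaDiag n ν * (pd μ (fun y => trH h y ν) x * divH v x μ ν)
      + contr v x (fun μ ν ρ => pd μ (pd ν fun y => trH h y ρ) x) := by
    rw [sum_mul_divH v x fun μ ν => pd μ (fun y => trH h y ν) x]
    simp only [contr, ← Finset.sum_add_distrib]
    refine Finset.sum_congr rfl fun μ _ => Finset.sum_congr rfl fun ν _ =>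
      Finset.sum_congr rfl fun ρ _ => ?_
    rw [pd_mul (hv μ ν ρ) ((hT ρ).partial_deriv ν)]
    ring
  have f : ∑ ρ, etaDiag n ρ * (trH v x ρ * trF h x ρ)
      = 2 * (∑ ν, etaDiag n ν * (trH v x ν *
          ∑ μ, etaDiag n μ * pd μ (pd μ fun y => trH h y ν) x))
        - 2 * (∑ ν, etaDiag n ν * (trH v x ν *
          ∑ μ, etaDiag n μ * pd μ (fun y => divH h y μ ν) x))
        + ∑ μ, etaDiag n μ * (trH v x μ * pd μ (fun y => divTr h y) x) := by
    simp only [trF_eq hh h₁ h₂]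
    rw [Finset.mul_sum, Finset.mul_sum, ← Finset.sum_sub_distrib, ← Finset.sum_add_distrib]
    exact Finset.sum_congr rfl fun ρ _ => by ring
  rw [contr_einstein v₁ v₂, contr_fronsdal hh h₁ h₂ v₁ v₂, f, boundaryTerm, n₁, n₂, n₃, n₄, n₅, n₆,
    lagBilin]
  simp only [mul_add (etaDiag n _ * etaDiag n _), Finset.sum_add_distrib]
  ring

lemma lag_add_smul (hh : ∀ μ ν ρ, IsTest fun x => h x μ ν ρ)
    (hv : ∀ μ ν ρ, IsTest fun x => v x μ ν ρ) (t : ℝ) (x : Fin n → ℝ) :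
    lag (fun x μ ν ρ => h x μ ν ρ + t * v x μ ν ρ) x
      = lag h x + t * (2 * lagBilin h v x) + t ^ 2 * lag v x := by
  have p (σ μ ν ρ : Fin n) : pd σ (fun y => h y μ ν ρ + t * v y μ ν ρ) x
      = pd σ (fun y => h y μ ν ρ) x + t * pd σ (fun y => v y μ ν ρ) x := by
    rw [pd_add (hh μ ν ρ) ((hv μ ν ρ).const_mul t), pd_const_mul t (hv μ ν ρ)]
  have tr (σ μ : Fin n) : pd σ (fun y => trH (fun x μ ν ρ => h x μ ν ρ + t * v x μ ν ρ) y μ) x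
      = pd σ (fun y => trH h y μ) x + t * pd σ (fun y => trH v y μ) x := by
    have (y : Fin n → ℝ) : trH (fun x μ ν ρ => h x μ ν ρ + t * v x μ ν ρ) y μ
        = trH h y μ + t * trH v y μ := by
      simp only [trH_eq, Finset.mul_sum, ← Finset.sum_add_distrib]
      exact Finset.sum_congr rfl fun ν _ => by ring
    simp only [this]
    rw [pd_add (isTest_trH hh μ) ((isTest_trH hv μ).const_mul t),
      pd_const_mul t (isTest_trH hv μ)]
  have d (μ ν : Fin n) : divH (fun x μ ν ρ => h x μ ν ρ + t * v x μ ν ρ) x μ ν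
      = divH h x μ ν + t * divH v x μ ν := by
    simp only [divH, p, Finset.mul_sum, ← Finset.sum_add_distrib]
    exact Finset.sum_congr rfl fun ν _ => by ring
  have dt : divTr (fun x μ ν ρ => h x μ ν ρ + t * v x μ ν ρ) x = divTr h x + t * divTr v x := by
    simp only [divTr, tr, Finset.mul_sum, ← Finset.sum_add_distrib]
    exact Finset.sum_congr rfl fun ν _ => by ring
  simp only [lag_eq_lagBilin, lagBilin, p, tr, d, dt]
  have expand (c a b a' b' : ℝ) : c * ((a + t * b) * (a' + t * b'))
      = c * (a * a') + t * (c * (a * b')) + t * (c * (a' * b)) + t ^ 2 * (c * (b * b')) := by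
    ring
  simp only [mul_add (etaDiag n _ * etaDiag n _), expand, Finset.sum_add_distrib, ← Finset.mul_sum,
    mul_comm (divH h x _ _) (pd _ (fun y => trH v y _) x)]
  ring

lemma integrable_lagBilin (hh : ∀ μ ν ρ, IsTest fun x => h x μ ν ρ)
    (hv : ∀ μ ν ρ, IsTest fun x => v x μ ν ρ) : Integrable (lagBilin h v) := by
  have hT := isTest_trH hh
  have vT := isTest_trH hv
  have hD := isTest_divH hh
  have vD := isTest_divH hv
  refine IsTest.integrable <| ((((IsTest.const_mul _ ?_).add (.const_mul _ ?_)).add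
    (.const_mul _ ?_)).add (.const_mul _ ((isTest_divTr hh).mul (isTest_divTr hv)))).sub
    (.const_mul _ ?_)
  · exact .sum _ fun σ => .sum _ fun μ => .sum _ fun ν => .sum _ fun ρ => .const_mul _ <|
      ((hh μ ν ρ).partial_deriv σ).mul ((hv μ ν ρ).partial_deriv σ)
  · exact .sum _ fun μ => .sum _ fun ν => .const_mul _ <| (hD μ ν).mul (vD μ ν)
  · exact .sum _ fun μ => .sum _ fun ν => .const_mul _ <|
      ((hT ν).partial_deriv μ).mul ((vT ν).partial_deriv μ)
  · exact .sum _ fun μ => .sum _ fun ν => .const_mul _ <|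
      (((hT ν).partial_deriv μ).mul (vD μ ν)).add (((vT ν).partial_deriv μ).mul (hD μ ν))

lemma action_add_smul (hh : ∀ μ ν ρ, IsTest fun x => h x μ ν ρ)
    (hv : ∀ μ ν ρ, IsTest fun x => v x μ ν ρ) (t : ℝ) :
    action (fun x μ ν ρ => h x μ ν ρ + t * v x μ ν ρ)
      = action h + t * (∫ x, 2 * lagBilin h v x) + t ^ 2 * action v := by
  have ih : Integrable fun x => lag h x := by
    simpa only [lag_eq_lagBilin] using integrable_lagBilin hh hh
  have iv : Integrable fun x => lag v x := by
    simpa only [lag_eq_lagBilin] using integrable_lagBilin hv hv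
  have ihv : Integrable fun x => t * (2 * lagBilin h v x) :=
    ((integrable_lagBilin hh hv).const_mul 2).const_mul t
  simp only [action, lag_add_smul hh hv]
  rw [integral_add (f := fun x => lag h x + t * (2 * lagBilin h v x)) (ih.add ihv)
    (iv.const_mul _), integral_add ih ihv, integral_const_mul t,
    integral_const_mul (t ^ 2)]

lemma deriv_action (hh : ∀ μ ν ρ, IsTest fun x => h x μ ν ρ)
    (hv : ∀ μ ν ρ, IsTest fun x => v x μ ν ρ) :
    deriv (fun t : ℝ => action fun x μ ν ρ => h x μ ν ρ + t * v x μ ν ρ) 0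
      = ∫ x, 2 * lagBilin h v x := by
  simp only [action_add_smul hh hv]
  have := (((hasDerivAt_id (0 : ℝ)).mul_const (∫ x, 2 * lagBilin h v x)).const_add
    (action h)).fun_add (((hasDerivAt_id (0 : ℝ)).fun_pow 2).mul_const (action v))
  simpa using this.deriv

lemma integral_two_mul_lagBilin (hh : ∀ μ ν ρ, IsTest fun x => h x μ ν ρ)
    (hv : ∀ μ ν ρ, IsTest fun x => v x μ ν ρ)
    (h₁ : ∀ x μ ν ρ, h x μ ν ρ = h x ν μ ρ) (h₂ : ∀ x μ ν ρ, h x μ ν ρ = h x μ ρ ν)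
    (v₁ : ∀ x μ ν ρ, v x μ ν ρ = v x ν μ ρ) (v₂ : ∀ x μ ν ρ, v x μ ν ρ = v x μ ρ ν) :
    ∫ x, 2 * lagBilin h v x = ∫ x, contr v x (einstein h x) := by
  have hb := isNull_boundaryTerm hh hv
  have hi := (integrable_lagBilin hh hv).const_mul 2
  have e : (fun x => contr v x (einstein h x))
      = fun x => 2 * lagBilin h v x - boundaryTerm h v x := by
    funext x
    rw [two_mul_lagBilin_eq hh hv h₁ h₂ v₁ v₂, add_sub_cancel_right]
  rw [e, integral_sub hi hb.1, hb.2, sub_zero]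

end Contractions

/-- **The Einstein tensor is the Euler–Lagrange derivative of the free spin-3
Lagrangian.**  For smooth, compactly supported spin-3 fields `h` and `v`, the
first variation of the free action satisfies
`(d/dt) S₀[h + t v] |_{t=0} = ∫ v_{μνρ} G^{μνρ}[h]` (indices raised with `η`). -/
theorem first_variation_of_free_action (n : ℕ) (hn : 1 ≤ n)
    (h v : Spin3 n)
    (hsmooth : ∀ μ ν ρ : Fin n, ContDiff ℝ (⊤ : ℕ∞) fun x => h x μ ν ρ)
    (hsupp : ∀ μ ν ρ : Fin n, HasCompactSupport fun x => h x μ ν ρ)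
    (hsym₁ : ∀ x μ ν ρ, h x μ ν ρ = h x ν μ ρ)
    (hsym₂ : ∀ x μ ν ρ, h x μ ν ρ = h x μ ρ ν)
    (vsmooth : ∀ μ ν ρ : Fin n, ContDiff ℝ (⊤ : ℕ∞) fun x => v x μ ν ρ)
    (vsupp : ∀ μ ν ρ : Fin n, HasCompactSupport fun x => v x μ ν ρ)
    (vsym₁ : ∀ x μ ν ρ, v x μ ν ρ = v x ν μ ρ)
    (vsym₂ : ∀ x μ ν ρ, v x μ ν ρ = v x μ ρ ν) :
    deriv (fun t : ℝ => action fun x μ ν ρ => h x μ ν ρ + t * v x μ ν ρ) 0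
      = ∫ x : Fin n → ℝ, ∑ μ, ∑ ν, ∑ ρ, ∑ μ', ∑ ν', ∑ ρ',
          eta n μ μ' * eta n ν ν' * eta n ρ ρ' * v x μ ν ρ * einstein h x μ' ν' ρ' := by
  have hh (μ ν ρ : Fin n) : IsTest fun x => h x μ ν ρ := ⟨hsmooth μ ν ρ, hsupp μ ν ρ⟩
  have hv (μ ν ρ : Fin n) : IsTest fun x => v x μ ν ρ := ⟨vsmooth μ ν ρ, vsupp μ ν ρ⟩
  rw [deriv_action hh hv, integral_two_mul_lagBilin hh hv hsym₁ hsym₂ vsym₁ vsym₂]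
  congr 1
  funext x
  simp only [contr, eta_eq_ite, ite_mul, mul_ite, zero_mul, mul_zero, Finset.sum_ite_eq,
    Finset.mem_univ, if_true, mul_assoc]
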